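/- arXiv:1307.0326 — 5 statements merged into one kernel-verified Lean document; each statement's English description precedes it below -/
import Mathlib

section
/- Let σ_e, σ_w > 0, Θ ∈ ℝ^{N_y×N_d}, and d_1,…,d_N ∈ ℝ^{N_d} with D the matrix whose columns are the d_t. Define F_θ := (1/σ_w²)·I_{N_y} ⊗ (D Dᵀ), F_{d_t} := (1/σ_e²)·I_{N_d} + (1/σ_w²)·ΘᵀΘ, and F_{θ,d_t} := (1/σ_w²)·H(d_t)ᵀ·Θ where H(d) := I_{N_y} ⊗ dᵀ. Then the Schur complement satisfies F_θ − ∑_{t=1}^N F_{θ,d_t}·F_{d_t}⁻¹·F_{θ,d_t}ᵀ = (1/σ_w²)·( I_{N_y} ⊗ (D Dᵀ) − σ_e²·∑_{t=1}^N H(d_t)ᵀ·Σ_Θ·H(d_t) ) = (1/σ_w²)·( (I_{N_y} − σ_e²·Σ_Θ) ⊗ (D Dᵀ) ), where Σ_Θ := Θ(σ_w²I + σ_e²ΘᵀΘ)⁻¹Θᵀ. -/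
open Matrix
open scoped Kronecker

/-- `Hmat d = I_{N_y} ⊗ dᵀ`: the Kronecker product of the `N_y × N_y` identity matrix with
the row vector `dᵀ`, with entry `H(d)_{i,(j,k)} = δ_{ij} d_k`. -/
def Hmat {Ny Nd : ℕ} (d : Fin Nd → ℝ) : Matrix (Fin Ny) (Fin Ny × Fin Nd) ℝ :=
  Matrix.of fun i jk => if i = jk.1 then d jk.2 else 0

theorem Hmat_transpose_mul_mul_Hmat {Ny Nd : ℕ} (S : Matrix (Fin Ny) (Fin Ny) ℝ)
    (d : Fin Nd → ℝ) :
    (Hmat (Ny := Ny) d)ᵀ * S * Hmat (Ny := Ny) d = S ⊗ₖ vecMulVec d d := by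
  ext ⟨i, k⟩ ⟨j, l⟩
  simp [Hmat, Matrix.mul_apply, vecMulVec_apply, kroneckerMap_apply]
  ring

theorem sum_Hmat_transpose_mul_mul_Hmat {Ny Nd N : ℕ} (S : Matrix (Fin Ny) (Fin Ny) ℝ)
    (d : Fin N → Fin Nd → ℝ) (D : Matrix (Fin Nd) (Fin N) ℝ)
    (hD : D = Matrix.of fun m t => d t m) :
    ∑ t, (Hmat (Ny := Ny) (d t))ᵀ * S * Hmat (Ny := Ny) (d t) = S ⊗ₖ (D * Dᵀ) := by
  subst hD
  ext ⟨i, k⟩ ⟨j, l⟩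
  simp [Hmat_transpose_mul_mul_Hmat, Matrix.sum_apply, Matrix.mul_apply, vecMulVec_apply,
    kroneckerMap_apply, Finset.mul_sum]

theorem posDef_smul_one_add_smul_gram {m n : Type*} [Fintype m] [Fintype n] [DecidableEq n]
    {a b : ℝ} (ha : 0 < a) (hb : 0 ≤ b) (Θ : Matrix m n ℝ) :
    (a • (1 : Matrix n n ℝ) + b • (Θᵀ * Θ)).PosDef :=
  (PosDef.one.smul ha).add_posSemidef ((posSemidef_conjTranspose_mul_self Θ).smul hb)

theorem inv_inv_smul_one_add_inv_smul_gram {m n : Type*} [Fintype m] [Fintype n] [DecidableEq n]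
    {a b : ℝ} (ha : 0 < a) (hb : 0 < b) (Θ : Matrix m n ℝ) :
    (b⁻¹ • (1 : Matrix n n ℝ) + a⁻¹ • (Θᵀ * Θ))⁻¹ =
      (a * b) • (a • (1 : Matrix n n ℝ) + b • (Θᵀ * Θ))⁻¹ := by
  have hM := (posDef_smul_one_add_smul_gram ha hb.le Θ).isUnit
  rw [Matrix.isUnit_iff_isUnit_det] at hM
  have h : b⁻¹ • (1 : Matrix n n ℝ) + a⁻¹ • (Θᵀ * Θ) =
      (a * b)⁻¹ • (a • (1 : Matrix n n ℝ) + b • (Θᵀ * Θ)) := by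
    rw [smul_add, smul_smul, smul_smul]
    congr 2 <;> field_simp
  apply Matrix.inv_eq_left_inv
  rw [h, Matrix.smul_mul, Matrix.mul_smul, Matrix.nonsing_inv_mul _ hM, smul_smul,
    mul_inv_cancel₀ (mul_pos ha hb).ne', one_smul]

/-- The Schur complement of the clairvoyant Fisher information matrix satisfies
`F_θ − ∑_t F_{θ,d_t} F_{d_t}⁻¹ F_{θ,d_t}ᵀ
  = (1/σ_w²)(I ⊗ (D Dᵀ) − σ_e² ∑_t H(d_t)ᵀ Σ_Θ H(d_t))
  = (1/σ_w²)((I − σ_e² Σ_Θ) ⊗ (D Dᵀ))`. -/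
theorem stmt_7 (Ny Nd N : ℕ) (hNy : 0 < Ny) (hNd : 0 < Nd) (hN : 0 < N)
    (σe σw : ℝ) (hσe : 0 < σe) (hσw : 0 < σw)
    (Θ : Matrix (Fin Ny) (Fin Nd) ℝ) (d : Fin N → Fin Nd → ℝ)
    (D : Matrix (Fin Nd) (Fin N) ℝ) (hD : D = Matrix.of fun m t => d t m)
    (Fθ : Matrix (Fin Ny × Fin Nd) (Fin Ny × Fin Nd) ℝ)
    (hFθ : Fθ = (σw ^ 2)⁻¹ • ((1 : Matrix (Fin Ny) (Fin Ny) ℝ) ⊗ₖ (D * Dᵀ)))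
    (Fd : Matrix (Fin Nd) (Fin Nd) ℝ)
    (hFd : Fd = (σe ^ 2)⁻¹ • (1 : Matrix (Fin Nd) (Fin Nd) ℝ) + (σw ^ 2)⁻¹ • (Θᵀ * Θ))
    (Fθd : Fin N → Matrix (Fin Ny × Fin Nd) (Fin Nd) ℝ)
    (hFθd : ∀ t, Fθd t = (σw ^ 2)⁻¹ • ((Hmat (Ny := Ny) (d t))ᵀ * Θ))
    (SΘ : Matrix (Fin Ny) (Fin Ny) ℝ)
    (hSΘ : SΘ = Θ * (σw ^ 2 • (1 : Matrix (Fin Nd) (Fin Nd) ℝ) + σe ^ 2 • (Θᵀ * Θ))⁻¹ * Θᵀ) :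
    (Fθ - ∑ t : Fin N, Fθd t * Fd⁻¹ * (Fθd t)ᵀ
        = (σw ^ 2)⁻¹ • ((1 : Matrix (Fin Ny) (Fin Ny) ℝ) ⊗ₖ (D * Dᵀ)
            - σe ^ 2 • ∑ t : Fin N, (Hmat (Ny := Ny) (d t))ᵀ * SΘ * Hmat (Ny := Ny) (d t))) ∧
    (Fθ - ∑ t : Fin N, Fθd t * Fd⁻¹ * (Fθd t)ᵀ
        = (σw ^ 2)⁻¹ • (((1 : Matrix (Fin Ny) (Fin Ny) ℝ) - σe ^ 2 • SΘ) ⊗ₖ (D * Dᵀ))) := by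
  have hw : 0 < σw ^ 2 := by positivity
  have he : 0 < σe ^ 2 := by positivity
  have hterm : ∀ t, Fθd t * Fd⁻¹ * (Fθd t)ᵀ =
      ((σw ^ 2)⁻¹ * σe ^ 2) • ((Hmat (Ny := Ny) (d t))ᵀ * SΘ * Hmat (Ny := Ny) (d t)) := by
    intro t
    rw [hFθd, hFd, hSΘ, inv_inv_smul_one_add_inv_smul_gram hw he]
    simp only [Matrix.transpose_smul, Matrix.transpose_mul, Matrix.transpose_transpose,
      Matrix.smul_mul, Matrix.mul_smul, smul_smul, Matrix.mul_assoc]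
    congr 1
    field_simp
  have hfirst : Fθ - ∑ t : Fin N, Fθd t * Fd⁻¹ * (Fθd t)ᵀ
      = (σw ^ 2)⁻¹ • ((1 : Matrix (Fin Ny) (Fin Ny) ℝ) ⊗ₖ (D * Dᵀ)
          - σe ^ 2 • ∑ t : Fin N, (Hmat (Ny := Ny) (d t))ᵀ * SΘ * Hmat (Ny := Ny) (d t)) := by
    simp only [hterm, hFθ, smul_sub, smul_smul, Finset.smul_sum]
  refine ⟨hfirst, ?_⟩
  rw [hfirst, sum_Hmat_transpose_mul_mul_Hmat SΘ d D hD, sub_eq_add_neg, sub_eq_add_neg,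
    add_kronecker, ← neg_smul, ← neg_smul, smul_kronecker]
end

section
/- Let σ_e, σ_w > 0, Θ ∈ ℝ^{N_y×N_d}, and d_1,…,d_N ∈ ℝ^{N_d} with D the matrix whose columns are the d_t, and suppose D Dᵀ is invertible. Then the clairvoyant Cramér–Rao bound matrix for θ admits the closed form σ_w²·( I_{N_y} ⊗ (D Dᵀ) − σ_e²·∑_{t=1}^N H(d_t)ᵀ·Σ_Θ·H(d_t) )⁻¹ = (σ_w²·I_{N_y} + σ_e²·ΘΘᵀ) ⊗ (D Dᵀ)⁻¹, where H(d) := I_{N_y} ⊗ dᵀ and Σ_Θ := Θ(σ_w²I + σ_e²ΘᵀΘ)⁻¹Θᵀ. -/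
open Matrix
open scoped Kronecker

theorem sum_transpose_Hmat_mul_mul_Hmat {Ny Nd N : ℕ} (d : Fin N → Fin Nd → ℝ)
    (S : Matrix (Fin Ny) (Fin Ny) ℝ) :
    ∑ t : Fin N, (Hmat (Ny := Ny) (d t))ᵀ * S * Hmat (Ny := Ny) (d t)
      = S ⊗ₖ ((Matrix.of fun m t => d t m) * (Matrix.of fun m t => d t m)ᵀ) := by
  ext ⟨i, k⟩ ⟨j, l⟩
  simp only [Matrix.sum_apply, Matrix.mul_apply, Matrix.transpose_apply, Hmat, Matrix.of_apply,
    Matrix.kroneckerMap_apply, ite_mul, zero_mul, mul_ite, mul_zero, Finset.sum_ite_eq',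
    Finset.mem_univ, if_true, Finset.mul_sum]
  exact Finset.sum_congr rfl fun t _ => by ring

theorem sub_kronecker {l m n p R : Type*} [Ring R] (A B : Matrix l m R) (C : Matrix n p R) :
    (A - B) ⊗ₖ C = A ⊗ₖ C - B ⊗ₖ C :=
  Matrix.ext fun _ _ => sub_mul _ _ _

theorem isUnit_smul_one_add_smul_transpose_mul_self {m n : Type*} [Fintype m] [Fintype n]
    [DecidableEq n] {a b : ℝ} (ha : 0 < a) (hb : 0 ≤ b) (Θ : Matrix m n ℝ) :
    IsUnit (a • (1 : Matrix n n ℝ) + b • (Θᵀ * Θ)) := by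
  have h : (Θᵀ * Θ).PosSemidef := by
    simpa using Matrix.posSemidef_conjTranspose_mul_self Θ
  exact ((Matrix.PosDef.one.smul ha).add_posSemidef (h.smul hb)).isUnit

theorem smul_one_add_smul_mul_one_sub {m n : Type*} [Fintype m] [Fintype n] [DecidableEq m]
    [DecidableEq n] {a b : ℝ} (ha : 0 < a) (hb : 0 ≤ b) (Θ : Matrix m n ℝ) :
    (a • (1 : Matrix m m ℝ) + b • (Θ * Θᵀ)) *
      (1 - b • (Θ * (a • (1 : Matrix n n ℝ) + b • (Θᵀ * Θ))⁻¹ * Θᵀ)) = a • 1 := by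
  set K := a • (1 : Matrix n n ℝ) + b • (Θᵀ * Θ) with hK
  have hdet : IsUnit K.det := (Matrix.isUnit_iff_isUnit_det _).1
    (isUnit_smul_one_add_smul_transpose_mul_self ha hb Θ)
  have hcomm : (a • (1 : Matrix m m ℝ) + b • (Θ * Θᵀ)) * Θ = Θ * K := by
    simp [hK, Matrix.add_mul, Matrix.mul_add, Matrix.mul_assoc]
  have hmul : (a • (1 : Matrix m m ℝ) + b • (Θ * Θᵀ)) * (Θ * K⁻¹ * Θᵀ) = Θ * Θᵀ := by
    rw [← Matrix.mul_assoc, ← Matrix.mul_assoc, hcomm, Matrix.mul_nonsing_inv_cancel_right _ _ hdet]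
  rw [Matrix.mul_sub, Matrix.mul_one, Matrix.mul_smul, hmul, add_sub_cancel_right]

/-- Closed form for the clairvoyant Cramér–Rao bound matrix for `θ`:
`σ_w²·(I ⊗ (D Dᵀ) − σ_e²·∑_t H(d_t)ᵀ Σ_Θ H(d_t))⁻¹ = (σ_w² I + σ_e² ΘΘᵀ) ⊗ (D Dᵀ)⁻¹`. -/
theorem stmt_8 (Ny Nd N : ℕ) (hNy : 0 < Ny) (hNd : 0 < Nd) (hN : 0 < N)
    (σe σw : ℝ) (hσe : 0 < σe) (hσw : 0 < σw)
    (Θ : Matrix (Fin Ny) (Fin Nd) ℝ) (d : Fin N → Fin Nd → ℝ)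
    (D : Matrix (Fin Nd) (Fin N) ℝ) (hD : D = Matrix.of fun m t => d t m)
    (hDDT : IsUnit (D * Dᵀ))
    (SΘ : Matrix (Fin Ny) (Fin Ny) ℝ)
    (hSΘ : SΘ = Θ * (σw ^ 2 • (1 : Matrix (Fin Nd) (Fin Nd) ℝ) + σe ^ 2 • (Θᵀ * Θ))⁻¹ * Θᵀ) :
    σw ^ 2 • ((1 : Matrix (Fin Ny) (Fin Ny) ℝ) ⊗ₖ (D * Dᵀ)
        - σe ^ 2 • ∑ t : Fin N, (Hmat (Ny := Ny) (d t))ᵀ * SΘ * Hmat (Ny := Ny) (d t))⁻¹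
      = (σw ^ 2 • (1 : Matrix (Fin Ny) (Fin Ny) ℝ) + σe ^ 2 • (Θ * Θᵀ)) ⊗ₖ (D * Dᵀ)⁻¹ := by
  have hw : (0 : ℝ) < σw ^ 2 := by positivity
  have hdet : IsUnit (D * Dᵀ).det := (Matrix.isUnit_iff_isUnit_det _).1 hDDT
  rw [sum_transpose_Hmat_mul_mul_Hmat, ← hD, ← Matrix.smul_kronecker, ← sub_kronecker]
  set A := σw ^ 2 • (1 : Matrix (Fin Ny) (Fin Ny) ℝ) + σe ^ 2 • (Θ * Θᵀ) with hA
  have hAS : A * (1 - σe ^ 2 • SΘ) = σw ^ 2 • 1 := by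
    rw [hA, hSΘ, smul_one_add_smul_mul_one_sub hw (sq_nonneg σe)]
  have hinv : ((1 - σe ^ 2 • SΘ) ⊗ₖ (D * Dᵀ))⁻¹ = (σw ^ 2)⁻¹ • (A ⊗ₖ (D * Dᵀ)⁻¹) := by
    apply Matrix.inv_eq_left_inv
    rw [Matrix.smul_mul, ← Matrix.mul_kronecker_mul, hAS, Matrix.nonsing_inv_mul _ hdet,
      Matrix.smul_kronecker, Matrix.one_kronecker_one, inv_smul_smul₀ hw.ne']
  rw [hinv, smul_inv_smul₀ hw.ne']
end

section
/- Let σ_e, σ_w > 0, Θ ∈ ℝ^{N_y×N_d}, and d_1,…,d_N ∈ ℝ^{N_d} with D the matrix whose columns are the d_t. Define the clairvoyant Fisher information matrix F as the symmetric block matrix with θ-block F_θ = (1/σ_w²)·I_{N_y} ⊗ (D Dᵀ), diagonal d-blocks F_{d_t} = (1/σ_e²)·I_{N_d} + (1/σ_w²)·ΘᵀΘ for t = 1,…,N, off-diagonal blocks F_{θ,d_t} = (1/σ_w²)·H(d_t)ᵀ·Θ between the θ-block and the d_t-block, and zero blocks between distinct d_s, d_t blocks, where H(d) := I_{N_y}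 ⊗ dᵀ. If D Dᵀ is invertible, then F is positive definite. -/
open Matrix
open scoped Kronecker

/-- A square root factor of the clairvoyant Fisher information matrix. -/
noncomputable def fisherFactor {Ny Nd N : ℕ} (σe σw : ℝ) (Θ : Matrix (Fin Ny) (Fin Nd) ℝ)
    (D : Matrix (Fin Nd) (Fin N) ℝ) :
    Matrix ((Fin Ny × Fin N) ⊕ (Fin N × Fin Nd)) ((Fin Ny × Fin Nd) ⊕ (Fin N × Fin Nd)) ℝ :=
  Matrix.fromBlocks
    (σw⁻¹ • ((1 : Matrix (Fin Ny) (Fin Ny) ℝ) ⊗ₖ Dᵀ))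
    (Matrix.of fun it sm => if it.2 = sm.1 then σw⁻¹ * Θ it.1 sm.2 else 0)
    0
    (σe⁻¹ • 1)

lemma one_kronecker_mulVec_apply {l m n R : Type*} [Fintype l] [DecidableEq l] [Fintype n]
    [CommSemiring R] (A : Matrix m n R) (v : l × n → R) (i : l) (j : m) :
    (((1 : Matrix l l R) ⊗ₖ A) *ᵥ v) (i, j) = (A *ᵥ fun k => v (i, k)) j := by
  simp [Matrix.mulVec, dotProduct, Fintype.sum_prod_type, Matrix.one_apply]

lemma fisherFactor_mulVec_injective {Ny Nd N : ℕ} {σe σw : ℝ} (hσe : σe ≠ 0) (hσw : σw ≠ 0)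
    (Θ : Matrix (Fin Ny) (Fin Nd) ℝ) (D : Matrix (Fin Nd) (Fin N) ℝ) (hD : IsUnit (D * Dᵀ)) :
    Function.Injective (fisherFactor σe σw Θ D).mulVec := by
  refine (injective_iff_map_eq_zero (fisherFactor σe σw Θ D).mulVecLin).2 fun x hx => ?_
  obtain ⟨u, v, rfl⟩ : ∃ u v, x = Sum.elim u v := ⟨_, _, (Sum.elim_comp_inl_inr x).symm⟩
  rw [Matrix.mulVecLin_apply, fisherFactor, Matrix.fromBlocks_mulVec] at hx
  have hv : v = 0 := by
    ext p
    simpa [Matrix.smul_mulVec, hσe] using congrFun hx (Sum.inr p)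
  subst hv
  have hu : u = 0 := by
    ext ⟨i, k⟩
    have hDu : (Dᵀ *ᵥ fun k => u (i, k)) = 0 := by
      ext t
      have h := congrFun hx (Sum.inl (i, t))
      simpa [Matrix.smul_mulVec, hσw, one_kronecker_mulVec_apply] using h
    have h0 : (D * Dᵀ) *ᵥ (fun k => u (i, k)) = (D * Dᵀ) *ᵥ 0 := by
      rw [← Matrix.mulVec_mulVec, hDu, Matrix.mulVec_zero, Matrix.mulVec_zero]
    exact congrFun (Matrix.mulVec_injective_of_isUnit hD h0) k
  subst hu
  simp

/-- The clairvoyant Fisher information matrix `F` (block matrix with θ-block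
`(1/σ_w²) I ⊗ (D Dᵀ)`, diagonal d-blocks `(1/σ_e²) I + (1/σ_w²) ΘᵀΘ`, off-diagonal
θ–d_t blocks `(1/σ_w²) H(d_t)ᵀ Θ`, and zero blocks between distinct d-blocks) is
positive definite whenever `D Dᵀ` is invertible. -/
theorem stmt_10 (Ny Nd N : ℕ) (hNy : 0 < Ny) (hNd : 0 < Nd) (hN : 0 < N)
    (σe σw : ℝ) (hσe : 0 < σe) (hσw : 0 < σw)
    (Θ : Matrix (Fin Ny) (Fin Nd) ℝ) (d : Fin N → Fin Nd → ℝ)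
    (D : Matrix (Fin Nd) (Fin N) ℝ) (hD : D = Matrix.of fun m t => d t m)
    (F : Matrix ((Fin Ny × Fin Nd) ⊕ (Fin N × Fin Nd))
               ((Fin Ny × Fin Nd) ⊕ (Fin N × Fin Nd)) ℝ)
    (hF : F = Matrix.fromBlocks
      ((σw ^ 2)⁻¹ • ((1 : Matrix (Fin Ny) (Fin Ny) ℝ) ⊗ₖ (D * Dᵀ)))
      (Matrix.of fun p tm =>
        ((σw ^ 2)⁻¹ • ((Hmat (Ny := Ny) (d tm.1))ᵀ * Θ)) p tm.2)
      (Matrix.of fun sm p =>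
        ((σw ^ 2)⁻¹ • ((Hmat (Ny := Ny) (d sm.1))ᵀ * Θ)) p sm.2)
      (Matrix.of fun sm tm => if sm.1 = tm.1 then
        ((σe ^ 2)⁻¹ • (1 : Matrix (Fin Nd) (Fin Nd) ℝ) + (σw ^ 2)⁻¹ • (Θᵀ * Θ)) sm.2 tm.2
        else 0))
    (hDDT : IsUnit (D * Dᵀ)) :
    F.PosDef := by
  have key : F = (fisherFactor σe σw Θ D)ᴴ * fisherFactor σe σw Θ D := by
    rw [hF, fisherFactor, Matrix.conjTranspose_eq_transpose_of_trivial,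
      Matrix.fromBlocks_transpose, Matrix.fromBlocks_multiply]
    congr 1
    · rw [Matrix.transpose_smul, ← Matrix.kroneckerMap_transpose, Matrix.transpose_one,
        Matrix.transpose_transpose, Matrix.smul_mul, Matrix.mul_smul,
        ← Matrix.mul_kronecker_mul, smul_smul, Matrix.one_mul, Matrix.transpose_zero,
        Matrix.zero_mul, add_zero, ← mul_inv, sq]
    · ext ⟨j, k⟩ ⟨s, m⟩
      simp [Matrix.mul_apply, Fintype.sum_prod_type, Hmat, hD, Matrix.one_apply]
      ring
    · ext ⟨s, m⟩ ⟨j, k⟩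
      simp [Matrix.mul_apply, Fintype.sum_prod_type, Hmat, hD, Matrix.one_apply]
      ring
    · ext ⟨s, m⟩ ⟨t, n⟩
      by_cases hst : s = t
      · subst hst
        simp [Matrix.mul_apply, Fintype.sum_prod_type, Matrix.one_apply, Finset.mul_sum]
        rw [add_comm]
        congr 1
        · exact Finset.sum_congr rfl fun i _ => by ring
        · rw [← mul_inv, sq]
      · simp [Matrix.mul_apply, Fintype.sum_prod_type, Matrix.one_apply, hst, Ne.symm hst]
  rw [key]
  exact Matrix.PosDef.conjTranspose_mul_self _
    (fisherFactor_mulVec_injective hσe.ne' hσw.ne' Θ D hDDT)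
end

section
/- Let σ_e, σ_w > 0, Θ ∈ ℝ^{N_y×N_d}, and d_1,…,d_N ∈ ℝ^{N_d} with D the matrix whose columns are the d_t, and suppose D Dᵀ is invertible. Let F be the clairvoyant Fisher information block matrix with θ-block (1/σ_w²)·I_{N_y} ⊗ (D Dᵀ), diagonal d-blocks (1/σ_e²)·I_{N_d} + (1/σ_w²)·ΘᵀΘ, off-diagonal θ–d_t blocks (1/σ_w²)·H(d_t)ᵀ·Θ (with H(d) := I_{N_y} ⊗ dᵀ), and zero blocks between distinct d-blocks. Then F is invertible, and the θ-block of F⁻¹ (i.e., the top-left block corresponding to the θ indices) equals (σ_w²·I_{N_y} + σ_e²·ΘΘᵀ) ⊗ (D Dᵀ)⁻¹. -/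
open Matrix
open scoped Kronecker

section KroneckerBlocks

variable {m n p q : Type*} [Fintype m] [Fintype n] [Fintype p] [Fintype q]
  [DecidableEq q]

/-- `b⁻¹ I + a⁻¹ ΘᵀΘ` is invertible for positive `a` and `b`. -/
theorem isUnit_smul_one_add_smul_transpose_mul_self_s11 {a b : ℝ} (ha : 0 < a) (hb : 0 < b)
    (Θ : Matrix p q ℝ) :
    IsUnit (b⁻¹ • (1 : Matrix q q ℝ) + a⁻¹ • (Θᵀ * Θ)) := by
  have h1 : (b⁻¹ • (1 : Matrix q q ℝ)).PosDef := PosDef.one.smul (inv_pos.2 hb)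
  have h2 : (a⁻¹ • (Θᵀ * Θ)).PosSemidef := by
    have := posSemidef_conjTranspose_mul_self Θ
    rw [conjTranspose_eq_transpose_of_trivial] at this
    exact this.smul (inv_pos.2 ha).le
  exact (h1.add_posSemidef h2).isUnit

variable [DecidableEq m] [DecidableEq n] [DecidableEq p]

/-- A right inverse of the block matrix with Kronecker product blocks
`a⁻¹ DDᵀ ⊗ I`, `a⁻¹ D ⊗ Θ`, `a⁻¹ Dᵀ ⊗ Θᵀ` and `I ⊗ (b⁻¹ I + a⁻¹ ΘᵀΘ)`. -/
theorem fromBlocks_kronecker_mul_eq_one {a b : ℝ} (ha : a ≠ 0) (hb : b ≠ 0)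
    (Θ : Matrix p q ℝ) (D : Matrix m n ℝ) (hD : IsUnit (D * Dᵀ))
    (M : Matrix q q ℝ) (hM : M = b⁻¹ • (1 : Matrix q q ℝ) + a⁻¹ • (Θᵀ * Θ)) (hMu : IsUnit M) :
    fromBlocks (a⁻¹ • ((D * Dᵀ) ⊗ₖ (1 : Matrix p p ℝ))) (a⁻¹ • (D ⊗ₖ Θ))
        (a⁻¹ • (Dᵀ ⊗ₖ Θᵀ)) ((1 : Matrix n n ℝ) ⊗ₖ M) *
      fromBlocks ((D * Dᵀ)⁻¹ ⊗ₖ (a • (1 : Matrix p p ℝ) + b • (Θ * Θᵀ)))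
        (-(((D * Dᵀ)⁻¹ * D) ⊗ₖ (b • Θ)))
        (-((Dᵀ * (D * Dᵀ)⁻¹) ⊗ₖ (b • Θᵀ)))
        ((1 : Matrix n n ℝ) ⊗ₖ M⁻¹
          + (Dᵀ * (D * Dᵀ)⁻¹ * D) ⊗ₖ (b • (1 : Matrix q q ℝ) - M⁻¹)) = 1 := by
  have hG := mul_nonsing_inv (D * Dᵀ) ((isUnit_iff_isUnit_det _).1 hD)
  have hMM := mul_nonsing_inv M ((isUnit_iff_isUnit_det _).1 hMu)
  have hG' : D * (Dᵀ * (D * Dᵀ)⁻¹) = 1 := by rw [← Matrix.mul_assoc, hG]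
  have hG'' : D * (Dᵀ * (D * Dᵀ)⁻¹ * D) = D := by
    rw [← Matrix.mul_assoc, hG', Matrix.one_mul]
  rw [fromBlocks_multiply, ← fromBlocks_one]
  congr 1
  · rw [Matrix.smul_mul, Matrix.smul_mul, Matrix.mul_neg, ← mul_kronecker_mul,
      ← mul_kronecker_mul, hG, hG', Matrix.one_mul, Matrix.mul_smul, kronecker_add, smul_neg,
      smul_add, add_neg_cancel_right, kronecker_smul, smul_smul, inv_mul_cancel₀ ha, one_smul,
      one_kronecker_one]
  · rw [Matrix.smul_mul, Matrix.smul_mul, Matrix.mul_neg, Matrix.mul_add, ← mul_kronecker_mul,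
      ← mul_kronecker_mul, ← mul_kronecker_mul, ← Matrix.mul_assoc (D * Dᵀ), hG, hG'',
      Matrix.one_mul, Matrix.one_mul, Matrix.mul_one, ← kronecker_add, ← Matrix.mul_add,
      add_sub_cancel, Matrix.mul_smul, Matrix.mul_one, smul_neg, neg_add_cancel]
  · have hS : a⁻¹ • (Θᵀ * (a • (1 : Matrix p p ℝ) + b • (Θ * Θᵀ))) = M * (b • Θᵀ) := by
      rw [hM]
      simp only [Matrix.mul_add, Matrix.add_mul, Matrix.mul_smul, Matrix.smul_mul, Matrix.mul_one,
        Matrix.one_mul, smul_add, smul_smul, inv_mul_cancel₀ ha, mul_inv_cancel₀ hb,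
        Matrix.mul_assoc, mul_comm]
    rw [Matrix.smul_mul, Matrix.mul_neg, ← mul_kronecker_mul, ← mul_kronecker_mul, ← hS,
      Matrix.one_mul, kronecker_smul, add_neg_cancel]
  · have hS : a⁻¹ • (Θᵀ * (b • Θ)) = b • M - 1 := by
      rw [hM, smul_add, smul_smul, mul_inv_cancel₀ hb, one_smul, add_sub_cancel_left,
        Matrix.mul_smul, smul_comm]
    rw [Matrix.smul_mul, Matrix.mul_neg, Matrix.mul_add, smul_neg, ← mul_kronecker_mul,
      ← mul_kronecker_mul, ← mul_kronecker_mul, ← kronecker_smul, hS, Matrix.mul_sub, hMM,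
      Matrix.mul_smul, Matrix.one_mul, Matrix.one_mul, Matrix.mul_one, one_kronecker_one,
      ← Matrix.mul_assoc Dᵀ]
    abel

end KroneckerBlocks

/-- The clairvoyant Fisher information matrix `F` is invertible and the θ-block of
`F⁻¹` (the top-left block) equals `(σ_w² I + σ_e² ΘΘᵀ) ⊗ (D Dᵀ)⁻¹`. -/
theorem stmt_11 (Ny Nd N : ℕ) (hNy : 0 < Ny) (hNd : 0 < Nd) (hN : 0 < N)
    (σe σw : ℝ) (hσe : 0 < σe) (hσw : 0 < σw)
    (Θ : Matrix (Fin Ny) (Fin Nd) ℝ) (d : Fin N → Fin Nd → ℝ)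
    (D : Matrix (Fin Nd) (Fin N) ℝ) (hD : D = Matrix.of fun m t => d t m)
    (hDDT : IsUnit (D * Dᵀ))
    (F : Matrix ((Fin Ny × Fin Nd) ⊕ (Fin N × Fin Nd))
               ((Fin Ny × Fin Nd) ⊕ (Fin N × Fin Nd)) ℝ)
    (hF : F = Matrix.fromBlocks
      ((σw ^ 2)⁻¹ • ((1 : Matrix (Fin Ny) (Fin Ny) ℝ) ⊗ₖ (D * Dᵀ)))
      (Matrix.of fun p tm =>
        ((σw ^ 2)⁻¹ • ((Hmat (Ny := Ny) (d tm.1))ᵀ * Θ)) p tm.2)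
      (Matrix.of fun sm p =>
        ((σw ^ 2)⁻¹ • ((Hmat (Ny := Ny) (d sm.1))ᵀ * Θ)) p sm.2)
      (Matrix.of fun sm tm => if sm.1 = tm.1 then
        ((σe ^ 2)⁻¹ • (1 : Matrix (Fin Nd) (Fin Nd) ℝ) + (σw ^ 2)⁻¹ • (Θᵀ * Θ)) sm.2 tm.2
        else 0)) :
    IsUnit F ∧
    (F⁻¹).toBlocks₁₁
      = (σw ^ 2 • (1 : Matrix (Fin Ny) (Fin Ny) ℝ) + σe ^ 2 • (Θ * Θᵀ)) ⊗ₖ (D * Dᵀ)⁻¹ := by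
  have ha : 0 < σw ^ 2 := by positivity
  have hb : 0 < σe ^ 2 := by positivity
  have hP := fromBlocks_kronecker_mul_eq_one ha.ne' hb.ne' Θ D hDDT _ rfl
    (isUnit_smul_one_add_smul_transpose_mul_self_s11 ha hb Θ)
  set e : (Fin Ny × Fin Nd) ⊕ (Fin N × Fin Nd) ≃ (Fin Nd × Fin Ny) ⊕ (Fin N × Fin Nd) :=
    Equiv.sumCongr (Equiv.prodComm _ _) (Equiv.refl _) with he
  have hFe : F = (fromBlocks ((σw ^ 2)⁻¹ • ((D * Dᵀ) ⊗ₖ (1 : Matrix (Fin Ny) (Fin Ny) ℝ)))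
      ((σw ^ 2)⁻¹ • (D ⊗ₖ Θ)) ((σw ^ 2)⁻¹ • (Dᵀ ⊗ₖ Θᵀ))
      ((1 : Matrix (Fin N) (Fin N) ℝ) ⊗ₖ
        ((σe ^ 2)⁻¹ • (1 : Matrix (Fin Nd) (Fin Nd) ℝ) + (σw ^ 2)⁻¹ • (Θᵀ * Θ)))).submatrix
      e e := by
    rw [hF]
    ext (⟨i, k⟩ | ⟨t, k⟩) (⟨j, l⟩ | ⟨s, l⟩)
    · simp [he, mul_comm]
    · simp [he, Matrix.mul_apply, Hmat, hD]
    · simp [he, Matrix.mul_apply, Hmat, hD]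
    · simp [he, Matrix.one_apply]
  refine ⟨?_, ?_⟩
  · rw [hFe, isUnit_submatrix_equiv]
    exact IsUnit.of_mul_eq_one _ hP
  · rw [hFe, inv_submatrix_equiv, inv_eq_right_inv hP]
    ext ⟨i, k⟩ ⟨j, l⟩
    simp [he, toBlocks₁₁, mul_comm]
end

section
/- Let p, q ∈ ℝ^M be nonzero vectors with pᵀq = 0, let N ≥ 2, and let D ∈ ℝ^{M×N} be a matrix each of whose columns d_i equals either p or q, with at least one column equal to p and at least one equal to q. Suppose D Dᵀ is invertible, and define the input-graph weight matrix W ∈ ℝ^{N×N} by w_{ij} := |d_iᵀ (D Dᵀ)⁻¹ d_j|. Then w_{ij} = 0 whenever d_i = p and d_j = q, and consequently the graph on vertex set {1,…,N} with an edge between i ≠ j exactly when w_{ij} > 0 is disconnected: no edge joins the set of indices with column p to the set of indices with column q, and both sets are nonempty. -/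
open Matrix

/-- If every column of `D` is either `q` or orthogonal to `q`, then `q` is an eigenvector of
`D Dᵀ`. -/
lemma mul_transpose_mulVec_eq_smul {m n R : Type*} [Fintype m] [Fintype n] [CommRing R]
    (D : Matrix m n R) (q : m → R) (h : ∀ i, D.col i = q ∨ D.col i ⬝ᵥ q = 0) :
    (D * Dᵀ) *ᵥ q = (∑ i, D.col i ⬝ᵥ q) • q := by
  rw [← mulVec_mulVec]
  ext k
  simp only [Pi.smul_apply, smul_eq_mul, Finset.sum_mul]
  refine Finset.sum_congr rfl fun i _ => ?_
  change D.col i k * (D.col i ⬝ᵥ q) = _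
  rcases h i with h | h
  · rw [h, mul_comm]
  · simp [h]

/-- A vector orthogonal to an eigenvector `q` of an invertible matrix `S` is also orthogonal to
`S⁻¹ q`. -/
lemma dotProduct_inv_mulVec_eq_zero {m K : Type*} [Fintype m] [DecidableEq m] [Field K]
    {S : Matrix m m K} (hS : IsUnit S) {p q : m → K} {c : K} (hc : S *ᵥ q = c • q)
    (hpq : p ⬝ᵥ q = 0) : p ⬝ᵥ S⁻¹ *ᵥ q = 0 := by
  have hq : c • (S⁻¹ *ᵥ q) = q := by
    rw [← mulVec_smul, ← hc, mulVec_mulVec,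
      nonsing_inv_mul _ ((isUnit_iff_isUnit_det S).1 hS), one_mulVec]
  rcases eq_or_ne c 0 with rfl | h0
  · rw [← hq]
    simp
  · rw [← hq, dotProduct_smul, smul_eq_mul] at hpq
    exact (mul_eq_zero.1 hpq).resolve_left h0

/-- A predicate preserved along edges is preserved along reachability. -/
lemma SimpleGraph.Reachable.imp_of_adj {V : Type*} {G : SimpleGraph V} {P : V → Prop}
    (h : ∀ u v, G.Adj u v → P u → P v) {u v : V} (huv : G.Reachable u v) (hu : P u) : P v := by
  obtain ⟨w⟩ := huv
  induction w with
  | nil => exact hu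
  | cons e _ ih => exact ih (h _ _ e hu)

/-- Orthogonal two-valued input: if every column of `D` equals `p` or `q` with `pᵀq = 0`
(both values occurring) and `D Dᵀ` is invertible, then the input-graph weight
`w_{ij} = |d_iᵀ (D Dᵀ)⁻¹ d_j|` vanishes between a `p`-column and a `q`-column, no edge of
the input graph joins the `p`-indices to the `q`-indices, and the input graph is
disconnected. -/
theorem stmt_13 (M N : ℕ) (hM : 0 < M) (hN : 2 ≤ N)
    (p q : Fin M → ℝ) (hp : p ≠ 0) (hq : q ≠ 0) (hpq : p ⬝ᵥ q = 0)
    (d : Fin N → Fin M → ℝ) (hcol : ∀ i, d i = p ∨ d i = q)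
    (hexp : ∃ i, d i = p) (hexq : ∃ j, d j = q)
    (D : Matrix (Fin M) (Fin N) ℝ) (hD : D = Matrix.of fun m i => d i m)
    (hDDT : IsUnit (D * Dᵀ))
    (w : Fin N → Fin N → ℝ)
    (hw : ∀ i j, w i j = |d i ⬝ᵥ (D * Dᵀ)⁻¹.mulVec (d j)|)
    (G : SimpleGraph (Fin N))
    (hG : G = SimpleGraph.fromRel fun i j => 0 < w i j) :
    (∀ i j, d i = p → d j = q → w i j = 0) ∧
    (∀ i j, d i = p → d j = q → ¬ G.Adj i j) ∧
    ¬ G.Connected := by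
  subst hD
  have hqp : q ⬝ᵥ p = 0 := by rw [dotProduct_comm, hpq]
  have hwpq : ∀ i j, d i = p → d j = q → w i j = 0 := fun i j hi hj => by
    rw [hw, hi, hj, abs_eq_zero]
    refine dotProduct_inv_mulVec_eq_zero hDDT
      (mul_transpose_mulVec_eq_smul _ q fun k => ?_) hpq
    change d k = q ∨ d k ⬝ᵥ q = 0
    exact (hcol k).symm.imp_right fun h => by rw [h, hpq]
  have hwqp : ∀ i j, d i = p → d j = q → w j i = 0 := fun i j hi hj => by
    rw [hw, hi, hj, abs_eq_zero]
    refine dotProduct_inv_mulVec_eq_zero hDDT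
      (mul_transpose_mulVec_eq_smul _ p fun k => ?_) hqp
    change d k = p ∨ d k ⬝ᵥ p = 0
    exact (hcol k).imp_right fun h => by rw [h, hqp]
  have hadj : ∀ i j, d i = p → d j = q → ¬ G.Adj i j := fun i j hi hj => by
    simp [hG, hwpq i j hi hj, hwqp i j hi hj]
  refine ⟨hwpq, hadj, fun hconn => ?_⟩
  obtain ⟨i, hi⟩ := hexp
  obtain ⟨j, hj⟩ := hexq
  have hjp : d j = p := (hconn.preconnected i j).imp_of_adj (P := fun k => d k = p)
    (fun u v huv hu => (hcol v).resolve_right fun hv => hadj u v hu hv huv) hi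
  rw [← hj, hjp] at hpq
  exact hp (dotProduct_self_eq_zero.1 hpq)
end
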